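/- arXiv:2202.01468 — 2 statements merged into one kernel-verified Lean document; each statement's English description precedes it below -/
import Mathlib

section
/- Let Ω be any nonempty subset of ℝⁿ and let ≿ be a continuous and complete preference relation on Ω. Then ≿ can be represented by a continuous utility function u : Ω → ℝ, i.e. there exists a continuous u : Ω → ℝ such that for all x, y ∈ Ω, x ≿ y if and only if u(x) ≥ u(y). -/
open Set Filter Topology

/-- In a linear order with the order topology, the running supremum of a bounded continuous
real function is continuous. -/
theorem continuous_sSup_image_Iic {L : Type*} [LinearOrder L] [TopologicalSpace L]
    [OrderTopology L] {f : L → ℝ} (hf : Continuous f) (hb : BddAbove (range f)) :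
    Continuous fun x => sSup (f '' Iic x) := by
  have hbdd (x : L) : BddAbove (f '' Iic x) := hb.mono (image_subset_range f _)
  have hle {y x : L} (h : y ≤ x) : f y ≤ sSup (f '' Iic x) := le_csSup (hbdd x) ⟨y, h, rfl⟩
  rw [continuous_iff_continuousAt]
  intro x
  rw [ContinuousAt, Metric.tendsto_nhds]
  intro ε hε
  have hnear : {y | |f y - f x| < ε / 3} ∈ 𝓝 x :=
    Metric.tendsto_nhds.1 hf.continuousAt (ε / 3) (by positivity)
  obtain ⟨s, hs, hconn, hsub⟩ : ∃ s ∈ 𝓝 x, s.OrdConnected ∧ s ⊆ {y | |f y - f x| < ε / 3} :=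
    ⟨_, ordConnectedComponent_mem_nhds.2 hnear, inferInstance, ordConnectedComponent_subset⟩
  have hosc {p q : L} (hp : p ∈ s) (hq : q ∈ s) (hpq : p ≤ q) :
      |sSup (f '' Iic q) - sSup (f '' Iic p)| ≤ 2 * (ε / 3) := by
    have hmono : sSup (f '' Iic p) ≤ sSup (f '' Iic q) :=
      csSup_le_csSup (hbdd q) ⟨f p, p, le_rfl, rfl⟩ (image_mono (Iic_subset_Iic.2 hpq))
    rw [abs_of_nonneg (sub_nonneg.2 hmono), sub_le_iff_le_add]
    refine csSup_le ⟨f q, q, le_rfl, rfl⟩ ?_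
    rintro _ ⟨y, hy, rfl⟩
    rcases le_total y p with hyp | hpy
    · linarith [hle hyp]
    · have h₁ := abs_lt.1 (show |f y - f x| < ε / 3 from hsub (hconn.out hp hq ⟨hpy, hy⟩))
      have h₂ := abs_lt.1 (show |f p - f x| < ε / 3 from hsub hp)
      linarith [hle (le_refl p)]
  filter_upwards [hs] with y hy
  have hx := mem_of_mem_nhds hs
  rw [Real.dist_eq]
  rcases le_total x y with h | h
  · linarith [hosc hx hy h]
  · rw [abs_sub_comm]
    linarith [hosc hy hx h]

/-- A monotone version of Urysohn's lemma for linear orders. -/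
theorem exists_continuous_monotone_lt {L : Type*} [LinearOrder L] [TopologicalSpace L]
    [OrderTopology L] {a b : L} (hab : a < b) :
    ∃ u : L → ℝ, Continuous u ∧ Monotone u ∧ (∀ x, u x ∈ Icc 0 1) ∧ u a < u b := by
  obtain ⟨f, hf0, hf1, hf⟩ := exists_continuous_zero_one_of_isClosed (isClosed_Iic (a := a))
    (isClosed_Ici (a := b)) (Set.disjoint_left.2 fun x hxa hxb =>
      (hab.trans_le (le_trans hxb hxa)).false)
  have hb : BddAbove (range f) := ⟨1, by rintro _ ⟨x, rfl⟩; exact (hf x).2⟩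
  have hbdd (x : L) : BddAbove (f '' Iic x) := hb.mono (image_subset_range f _)
  have hle (x : L) : f x ≤ sSup (f '' Iic x) := le_csSup (hbdd x) ⟨x, le_rfl, rfl⟩
  refine ⟨fun x => sSup (f '' Iic x), continuous_sSup_image_Iic f.continuous hb, ?_, ?_, ?_⟩
  · intro x y hxy
    exact csSup_le_csSup (hbdd y) ⟨f x, x, le_rfl, rfl⟩ (image_mono (Iic_subset_Iic.2 hxy))
  · intro x
    refine ⟨(hf x).1.trans (hle x), csSup_le ⟨f x, x, le_rfl, rfl⟩ ?_⟩
    rintro _ ⟨y, -, rfl⟩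
    exact (hf y).2
  · have ha : sSup (f '' Iic a) ≤ 0 := by
      refine csSup_le ⟨f a, a, le_rfl, rfl⟩ ?_
      rintro _ ⟨y, hy, rfl⟩
      exact (hf0 hy).le
    have h1 : f b = 1 := hf1 (self_mem_Ici (a := b))
    linarith [hle b]

/-- A continuous map from a second-countable space to a linear order can be composed with a
continuous monotone real function which is strictly monotone on its range. -/
theorem exists_continuous_monotone_strictMonoOn_range {X L : Type*} [TopologicalSpace X]
    [SecondCountableTopology X] [LinearOrder L] [TopologicalSpace L] [OrderTopology L]
    {π : X → L} (hπ : Continuous π) :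
    ∃ u : L → ℝ, Continuous u ∧ Monotone u ∧ StrictMonoOn u (range π) := by
  let ι := {u : L → ℝ // Continuous u ∧ Monotone u ∧ ∀ x, u x ∈ Icc (0 : ℝ) 1}
  let S : ι → Set (X × X) := fun u => {p | u.1 (π p.1) < u.1 (π p.2)}
  have hS (u : ι) : IsOpen (S u) :=
    isOpen_lt (u.2.1.comp (hπ.comp continuous_fst)) (u.2.1.comp (hπ.comp continuous_snd))
  obtain ⟨T, hT, hTS⟩ := TopologicalSpace.isOpen_iUnion_countable S hS
  have := hT.toEncodable
  obtain ⟨w, hw, c, hc, -⟩ := posSumOfEncodable one_pos T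
  have hbound (i : T) (x : L) : ‖w i * i.1.1 x‖ ≤ w i := by
    obtain ⟨h0, h1⟩ := i.1.2.2.2 x
    rw [Real.norm_of_nonneg (mul_nonneg (hw i).le h0)]
    exact mul_le_of_le_one_right (hw i).le h1
  have hsum (x : L) : Summable fun i : T => w i * i.1.1 x :=
    hc.summable.of_norm_bounded fun i => hbound i x
  have hterm {x y : L} (hxy : x ≤ y) (i : T) : w i * i.1.1 x ≤ w i * i.1.1 y :=
    mul_le_mul_of_nonneg_left (i.1.2.2.1 hxy) (hw i).le
  refine ⟨fun x => ∑' i : T, w i * i.1.1 x,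
    continuous_tsum (fun i => continuous_const.mul i.1.2.1) hc.summable hbound,
    fun x y hxy => (hsum x).tsum_le_tsum (hterm hxy) (hsum y), ?_⟩
  rintro _ ⟨x, rfl⟩ _ ⟨y, rfl⟩ hxy
  obtain ⟨u, hu, hmono, h01, hlt⟩ := exists_continuous_monotone_lt hxy
  have hmem : (x, y) ∈ ⋃ i ∈ T, S i := hTS ▸ mem_iUnion.2 ⟨⟨u, hu, hmono, h01⟩, hlt⟩
  obtain ⟨i, hi, hixy⟩ := mem_iUnion₂.1 hmem
  exact Summable.tsum_lt_tsum (i := ⟨i, hi⟩) (hterm hxy.le)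
    (mul_lt_mul_of_pos_left hixy (hw _)) (hsum _) (hsum _)

/-- A total preorder with closed rays on a second-countable space is represented by a continuous
real function. -/
theorem exists_continuous_le_iff_le {X : Type*} [TopologicalSpace X] [SecondCountableTopology X]
    [Preorder X] [Std.Total (α := X) (· ≤ ·)] [ClosedIicTopology X] [ClosedIciTopology X] :
    ∃ u : X → ℝ, Continuous u ∧ ∀ x y, x ≤ y ↔ u x ≤ u y := by
  classical
  let : TopologicalSpace (Antisymmetrization X (· ≤ ·)) := Preorder.topology _
  have : OrderTopology (Antisymmetrization X (· ≤ ·)) := ⟨rfl⟩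
  have hlt {x y : X} : x < y ↔ ¬y ≤ x :=
    ⟨fun h => h.not_ge, fun h => lt_of_le_not_ge ((Std.Total.total x y).resolve_right h) h⟩
  have hπ : Continuous (toAntisymmetrization (α := X) (· ≤ ·)) := by
    refine continuous_generateFrom_iff.2 ?_
    rintro _ ⟨a, rfl | rfl⟩ <;> induction a using Antisymmetrization.ind with | _ a
    · convert (isClosed_Iic (a := a)).isOpen_compl using 1
      ext x
      simp [hlt]
    · convert (isClosed_Ici (a := a)).isOpen_compl using 1
      ext x
      simp [hlt]
  obtain ⟨u, hu, -, hstrict⟩ := exists_continuous_monotone_strictMonoOn_range hπ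
  refine ⟨_, hu.comp hπ, fun x y => ?_⟩
  rw [← toAntisymmetrization_le_toAntisymmetrization_iff]
  exact (hstrict.le_iff_le (mem_range_self x) (mem_range_self y)).symm

/-- **Debreu's Utility Representation Theorem for ℝⁿ.**
Let `Ω` be any nonempty subset of `ℝⁿ` and `≿` (here `R`) a complete preference
relation on `Ω` that is continuous (upper and lower contour sets closed in `Ω`).
Then `≿` is represented by a continuous utility function `u : Ω → ℝ`:
`x ≿ y ↔ u x ≥ u y` for all `x, y ∈ Ω`. -/
theorem debreu_utility_representation
    (n : ℕ) (Ω : Set (EuclideanSpace ℝ (Fin n))) (hne : Ω.Nonempty)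
    (R : EuclideanSpace ℝ (Fin n) → EuclideanSpace ℝ (Fin n) → Prop)
    (hrefl : ∀ x ∈ Ω, R x x)
    (htrans : ∀ x ∈ Ω, ∀ y ∈ Ω, ∀ z ∈ Ω, R x y → R y z → R x z)
    (htotal : ∀ x ∈ Ω, ∀ y ∈ Ω, R x y ∨ R y x)
    (hcont : ∀ x ∈ Ω,
      IsClosed {y : Ω | R (y : EuclideanSpace ℝ (Fin n)) x} ∧
      IsClosed {y : Ω | R x (y : EuclideanSpace ℝ (Fin n))}) :
    ∃ u : Ω → ℝ, Continuous u ∧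
      ∀ x y : Ω, (R (x : EuclideanSpace ℝ (Fin n)) (y : EuclideanSpace ℝ (Fin n)) ↔ u x ≥ u y) := by
  let : Preorder Ω :=
    { le := fun x y => R y x
      le_refl := fun x => hrefl x x.2
      le_trans := fun x y z hxy hyz => htrans z z.2 y y.2 x x.2 hyz hxy }
  have : Std.Total (α := Ω) (· ≤ ·) := ⟨fun x y => htotal y y.2 x x.2⟩
  have : ClosedIicTopology Ω := ⟨fun x => (hcont x x.2).2⟩
  have : ClosedIciTopology Ω := ⟨fun x => (hcont x x.2).1⟩
  obtain ⟨u, hu, hle⟩ := exists_continuous_le_iff_le (X := Ω)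
  exact ⟨u, hu, fun x y => hle y x⟩
end

section
/- Let X = {x₁, …, x_N} ⊂ ℝⁿ be a finite set of distinct points. Then the associated IDW distance function z is continuous on all of ℝⁿ; in particular, z(x) → 0 as x → xⱼ for every xⱼ ∈ X. -/
open Filter

/-- The reciprocal of a sum of inverse squared distances is at most each squared distance. -/
lemma one_div_sum_one_div_norm_sq_le {ι E : Type*} [Fintype ι] [NormedAddCommGroup E]
    (p : ι → E) {x : E} (j : ι) (hx : x ≠ p j) :
    1 / ∑ i, 1 / ‖x - p i‖ ^ 2 ≤ ‖x - p j‖ ^ 2 := by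
  have hpos : 0 < ‖x - p j‖ ^ 2 := pow_pos (norm_pos_iff.2 (sub_ne_zero.2 hx)) 2
  have hle : 1 / ‖x - p j‖ ^ 2 ≤ ∑ i, 1 / ‖x - p i‖ ^ 2 :=
    Finset.single_le_sum (f := fun i => 1 / ‖x - p i‖ ^ 2)
      (fun i _ => by positivity) (Finset.mem_univ j)
  simpa using one_div_le_one_div_of_le (one_div_pos.2 hpos) hle

/-- The reciprocal of the sum of inverse squared distances is continuous off the points. -/
lemma continuousAt_one_div_sum_one_div_norm_sq {ι E : Type*} [Fintype ι] [NormedAddCommGroup E]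
    (p : ι → E) {x : E} (hx : x ∉ Set.range p) :
    ContinuousAt (fun y => 1 / ∑ i, 1 / ‖y - p i‖ ^ 2) x := by
  have hpos (i : ι) : 0 < ‖x - p i‖ ^ 2 :=
    pow_pos (norm_pos_iff.2 (sub_ne_zero.2 fun h => hx ⟨i, h.symm⟩)) 2
  rcases isEmpty_or_nonempty ι with _ | _
  · simpa using continuousAt_const
  · have hsum : ∑ i, 1 / ‖x - p i‖ ^ 2 ≠ 0 :=
      (Finset.sum_pos (fun i _ => one_div_pos.2 (hpos i)) Finset.univ_nonempty).ne'
    refine continuousAt_const.div (tendsto_finsetSum _ fun i _ => ?_) hsum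
    exact ContinuousAt.div (by fun_prop) (by fun_prop) (hpos i).ne'

/-- **Continuity of the IDW distance function.**
Let `X = {x₁, …, x_N} ⊂ ℝⁿ` be distinct points and let `z` be the IDW distance
function: `z(x) = 0` for `x ∈ X` and
`z(x) = −(2/π)·arctan(1 / Σᵢ 1/‖x − xᵢ‖²)` otherwise. Then `z` is continuous on
all of `ℝⁿ`; in particular `z(x) → 0` as `x → xⱼ` for every `xⱼ ∈ X`. -/
theorem idw_distance_continuous
    (n N : ℕ)
    (pts : Fin N → EuclideanSpace ℝ (Fin n))
    (hinj : Function.Injective pts)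
    (z : EuclideanSpace ℝ (Fin n) → ℝ)
    (hz0 : ∀ x ∈ Set.range pts, z x = 0)
    (hz1 : ∀ x ∉ Set.range pts,
      z x = -(2 / Real.pi) * Real.arctan (1 / ∑ i, 1 / ‖x - pts i‖ ^ 2)) :
    Continuous z ∧ ∀ j : Fin N, Tendsto z (nhds (pts j)) (nhds 0) := by
  have hlim (j : Fin N) : Tendsto z (nhds (pts j)) (nhds 0) := by
    have hbound : Tendsto (fun x => 2 / Real.pi * Real.arctan (‖x - pts j‖ ^ 2))
        (nhds (pts j)) (nhds 0) := by
      have hcont : Continuous fun x => 2 / Real.pi * Real.arctan (‖x - pts j‖ ^ 2) := by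
        fun_prop
      simpa using hcont.tendsto (pts j)
    refine squeeze_zero_norm (fun x => ?_) hbound
    by_cases hx : x ∈ Set.range pts
    · rw [hz0 x hx, norm_zero]
      have := Real.arctan_nonneg.2 (sq_nonneg ‖x - pts j‖)
      positivity
    · have hnonneg : 0 ≤ Real.arctan (1 / ∑ i, 1 / ‖x - pts i‖ ^ 2) :=
        Real.arctan_nonneg.2 (by positivity)
      rw [hz1 x hx, neg_mul, norm_neg, Real.norm_of_nonneg (by positivity)]
      gcongr
      exact one_div_sum_one_div_norm_sq_le pts j fun h => hx ⟨j, h.symm⟩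
  refine ⟨continuous_iff_continuousAt.2 fun x => ?_, hlim⟩
  by_cases hx : x ∈ Set.range pts
  · obtain ⟨j, rfl⟩ := hx
    simpa only [ContinuousAt, hz0 _ (Set.mem_range_self j)] using hlim j
  · have hnear : ∀ᶠ y in nhds x, y ∉ Set.range pts :=
      (Set.finite_range pts).isClosed.isOpen_compl.mem_nhds hx
    refine ContinuousAt.congr ?_ (hnear.mono fun y hy => (hz1 y hy).symm)
    exact continuousAt_const.mul <|
      Real.continuous_arctan.continuousAt.comp (continuousAt_one_div_sum_one_div_norm_sq pts hx)
end
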